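/- arXiv:2410.04397 — 3 statements merged into one kernel-verified Lean document; each statement's English description precedes it below -/
import Mathlib

section
/- Let G be a finite additive commutative group, let X and Z be G-valued random variables, and let M be a random variable with values in a finite type, all on a common probability space. Suppose (a) Z is independent of the joint random variable (X, M), and (b) for every m with P(M = m) > 0, the map (x, z) ↦ x + z is injective on the set {x ∈ G : P(X = x, M = m) > 0} × {z ∈ G : P(Z = z) > 0}. Then H(X + Z | M) = H(X | M) + H(Z). -/
open MeasureTheory ProbabilityTheory

/-- Shannon entropy of a finite-valued random variable `X` under measure `μ`:
`H(X) = ∑ x, −P(X = x) · log P(X = x)`. -/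
noncomputable def entropy {Ω S : Type*} [MeasurableSpace Ω] [Fintype S]
    (μ : Measure Ω) (X : Ω → S) : ℝ :=
  ∑ x : S, Real.negMulLog (μ (X ⁻¹' {x})).toReal

/-- Conditional entropy `H(X | Y) = ∑ y, P(Y = y) · H(X | Y = y)`, where the inner
entropy is taken under the conditional probability measure given `{Y = y}`. -/
noncomputable def condEntropy {Ω S T : Type*} [MeasurableSpace Ω] [Fintype S] [Fintype T]
    (μ : Measure Ω) (X : Ω → S) (Y : Ω → T) : ℝ :=
  ∑ y : T, (μ (Y ⁻¹' {y})).toReal * entropy (μ[|Y ⁻¹' {y}]) X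

/-- Mutual information `I(X ; Y) = H(X) − H(X | Y)`. -/
noncomputable def mutualInfo {Ω S T : Type*} [MeasurableSpace Ω] [Fintype S] [Fintype T]
    (μ : Measure Ω) (X : Ω → S) (Y : Ω → T) : ℝ :=
  entropy μ X - condEntropy μ X Y

/-- Entropy is invariant under maps that are injective on the support. -/
theorem entropy_comp_of_injOn {Ω S S' : Type*} [MeasurableSpace Ω] [Fintype S] [Fintype S']
    [MeasurableSpace S] [MeasurableSingletonClass S] (μ : Measure Ω) [IsFiniteMeasure μ]
    {W : Ω → S} (hW : Measurable W) {f : S → S'}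
    (hf : Set.InjOn f {s | 0 < μ (W ⁻¹' {s})}) :
    entropy μ (fun ω => f (W ω)) = entropy μ W := by
  classical
  unfold entropy
  rw [← Finset.sum_fiberwise Finset.univ f]
  refine Finset.sum_congr rfl fun t _ => ?_
  have hμ : μ ((fun ω => f (W ω)) ⁻¹' {t}) = ∑ s with f s = t, μ (W ⁻¹' {s}) := by
    rw [sum_measure_preimage_singleton _ fun s _ => hW (measurableSet_singleton s)]
    congr 1
    ext ω
    simp
  rw [hμ]
  by_cases h : ∃ s, f s = t ∧ 0 < μ (W ⁻¹' {s})
  · obtain ⟨s, rfl, hs⟩ := h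
    have hz : ∀ s' ∈ Finset.univ.filter (fun s' => f s' = f s), s' ≠ s →
        μ (W ⁻¹' {s'}) = 0 := by
      intro s' hs' hne
      by_contra h0
      exact hne (hf (pos_iff_ne_zero.2 h0) hs (by simpa using hs'))
    rw [Finset.sum_eq_single_of_mem s (by simp) hz,
      Finset.sum_eq_single_of_mem s (by simp) fun s' hs' hne => by simp [hz s' hs' hne]]
  · push Not at h
    have hz : ∀ s ∈ Finset.univ.filter (fun s => f s = t), μ (W ⁻¹' {s}) = 0 :=
      fun s hs => le_antisymm (h s (by simpa using hs)) zero_le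
    rw [Finset.sum_eq_zero hz, Finset.sum_eq_zero fun s hs => by simp [hz s hs]]
    simp

/-- The probabilities of the atoms of a finite-valued random variable sum to one. -/
theorem sum_toReal_measure_preimage_singleton {Ω S : Type*} [MeasurableSpace Ω] [Fintype S]
    [MeasurableSpace S] [MeasurableSingletonClass S] (μ : Measure Ω) [IsProbabilityMeasure μ]
    {X : Ω → S} (hX : Measurable X) : ∑ x : S, (μ (X ⁻¹' {x})).toReal = 1 := by
  rw [← ENNReal.toReal_sum fun _ _ => measure_ne_top _ _,
    sum_measure_preimage_singleton _ fun s _ => hX (measurableSet_singleton s)]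
  simp

/-- Entropy is additive on independent pairs. -/
theorem entropy_prodMk_of_indepFun {Ω S T : Type*} [MeasurableSpace Ω] [Fintype S] [Fintype T]
    [MeasurableSpace S] [MeasurableSingletonClass S]
    [MeasurableSpace T] [MeasurableSingletonClass T]
    (μ : Measure Ω) [IsProbabilityMeasure μ] {X : Ω → S} {Y : Ω → T}
    (hX : Measurable X) (hY : Measurable Y) (h : IndepFun X Y μ) :
    entropy μ (fun ω => (X ω, Y ω)) = entropy μ X + entropy μ Y := by
  have hxy : ∀ x y, (μ ((fun ω => (X ω, Y ω)) ⁻¹' {(x, y)})).toReal =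
      (μ (X ⁻¹' {x})).toReal * (μ (Y ⁻¹' {y})).toReal := by
    intro x y
    rw [← ENNReal.toReal_mul, ← h.measure_inter_preimage_eq_mul _ _
      (measurableSet_singleton x) (measurableSet_singleton y)]
    congr 2
    ext ω
    simp
  unfold entropy
  simp_rw [Fintype.sum_prod_type, hxy, Real.negMulLog_mul, Finset.sum_add_distrib,
    ← Finset.sum_mul, ← Finset.mul_sum, ← Finset.sum_mul,
    sum_toReal_measure_preimage_singleton μ hX, sum_toReal_measure_preimage_singleton μ hY,
    one_mul]

/-- If `Z` is independent of `(X, M)`, conditioning on an event of `M` preserves the law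
of `Z`. -/
theorem cond_preimage_of_indepFun_prodMk {Ω S R T : Type*} [MeasurableSpace Ω]
    [MeasurableSpace S] [MeasurableSpace R] [MeasurableSpace T]
    (μ : Measure Ω) [IsProbabilityMeasure μ] {X : Ω → S} {Z : Ω → R} {M : Ω → T}
    (hM : Measurable M) (h : IndepFun Z (fun ω => (X ω, M ω)) μ)
    {s : Set T} (hs : MeasurableSet s) (h0 : μ (M ⁻¹' s) ≠ 0)
    {t : Set R} (ht : MeasurableSet t) :
    μ[|M ⁻¹' s] (Z ⁻¹' t) = μ (Z ⁻¹' t) := by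
  have hZM : IndepFun Z M μ := h.comp measurable_id measurable_snd
  rw [cond_apply (hM hs), Set.inter_comm, hZM.measure_inter_preimage_eq_mul _ _ ht hs,
    mul_comm, mul_assoc, ENNReal.mul_inv_cancel h0 (measure_ne_top _ _), mul_one]

/-- If `Z` is independent of `(X, M)`, then `X` and `Z` are independent conditionally on
any event of `M` of positive probability. -/
theorem IndepFun.cond_of_prodMk {Ω S R T : Type*} [MeasurableSpace Ω]
    [MeasurableSpace S] [MeasurableSpace R] [MeasurableSpace T]
    (μ : Measure Ω) [IsProbabilityMeasure μ] {X : Ω → S} {Z : Ω → R} {M : Ω → T}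
    (hM : Measurable M) (h : IndepFun Z (fun ω => (X ω, M ω)) μ)
    {s : Set T} (hs : MeasurableSet s) (h0 : μ (M ⁻¹' s) ≠ 0) :
    IndepFun X Z μ[|M ⁻¹' s] := by
  rw [indepFun_iff_measure_inter_preimage_eq_mul]
  intro a b ha hb
  rw [cond_preimage_of_indepFun_prodMk μ hM h hs h0 hb, cond_apply (hM hs),
    cond_apply (hM hs)]
  have hset : M ⁻¹' s ∩ (X ⁻¹' a ∩ Z ⁻¹' b) =
      Z ⁻¹' b ∩ (fun ω => (X ω, M ω)) ⁻¹' (a ×ˢ s) := by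
    ext ω
    simp only [Set.mem_inter_iff, Set.mem_preimage, Set.mem_prod]
    tauto
  have hset' : M ⁻¹' s ∩ X ⁻¹' a = (fun ω => (X ω, M ω)) ⁻¹' (a ×ˢ s) := by
    ext ω
    simp only [Set.mem_inter_iff, Set.mem_preimage, Set.mem_prod]
    tauto
  rw [hset, hset', h.measure_inter_preimage_eq_mul _ _ hb (ha.prod hs)]
  ring

/-- If `Z` is independent of `(X, M)` and, conditionally on each positive-probability
atom `{M = m}`, the addition map is injective on the product of the supports of `X`
(jointly with `{M = m}`) and of `Z`, then `H(X + Z | M) = H(X | M) + H(Z)`. -/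
theorem condEntropy_add_eq_add_of_indep_of_injOn
    {Ω : Type*} [MeasurableSpace Ω] (μ : Measure Ω) [IsProbabilityMeasure μ]
    {G : Type*} [Fintype G] [AddCommGroup G]
    [MeasurableSpace G] [DiscreteMeasurableSpace G]
    {T : Type*} [Fintype T] [MeasurableSpace T] [DiscreteMeasurableSpace T]
    (X Z : Ω → G) (M : Ω → T)
    (hX : Measurable X) (hZ : Measurable Z) (hM : Measurable M)
    (hIndep : IndepFun Z (fun ω => (X ω, M ω)) μ)
    (hInj : ∀ m : T, 0 < μ (M ⁻¹' {m}) →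
      Set.InjOn (fun p : G × G => p.1 + p.2)
        ({x : G | 0 < μ (X ⁻¹' {x} ∩ M ⁻¹' {m})} ×ˢ {z : G | 0 < μ (Z ⁻¹' {z})})) :
    condEntropy μ (fun ω => X ω + Z ω) M = condEntropy μ X M + entropy μ Z := by
  have key : ∀ m : T, (μ (M ⁻¹' {m})).toReal *
      entropy (μ[|M ⁻¹' {m}]) (fun ω => X ω + Z ω) =
      (μ (M ⁻¹' {m})).toReal * entropy (μ[|M ⁻¹' {m}]) X +
        (μ (M ⁻¹' {m})).toReal * entropy μ Z := by
    intro m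
    rcases eq_or_ne (μ (M ⁻¹' {m})) 0 with h0 | h0
    · simp [h0]
    have hm : MeasurableSet ({m} : Set T) := measurableSet_singleton m
    have : IsProbabilityMeasure μ[|M ⁻¹' {m}] := cond_isProbabilityMeasure h0
    have hZlaw : entropy (μ[|M ⁻¹' {m}]) Z = entropy μ Z := by
      unfold entropy
      simp_rw [cond_preimage_of_indepFun_prodMk μ hM hIndep hm h0 (measurableSet_singleton _)]
    have hinj : Set.InjOn (fun p : G × G => p.1 + p.2)
        {p | 0 < μ[|M ⁻¹' {m}] ((fun ω => (X ω, Z ω)) ⁻¹' {p})} := by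
      refine (hInj m (pos_iff_ne_zero.2 h0)).mono ?_
      rintro ⟨x, z⟩ hp
      refine ⟨?_, ?_⟩
      · have hx : 0 < μ[|M ⁻¹' {m}] (X ⁻¹' {x}) :=
          lt_of_lt_of_le hp (measure_mono fun ω hω => congrArg Prod.fst hω)
        rw [cond_apply (hM hm), Set.inter_comm] at hx
        exact pos_iff_ne_zero.2 (right_ne_zero_of_mul hx.ne')
      · have hz : 0 < μ[|M ⁻¹' {m}] (Z ⁻¹' {z}) :=
          lt_of_lt_of_le hp (measure_mono fun ω hω => congrArg Prod.snd hω)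
        rwa [cond_preimage_of_indepFun_prodMk μ hM hIndep hm h0
          (measurableSet_singleton _)] at hz
    rw [entropy_comp_of_injOn _ (hX.prodMk hZ) hinj,
      entropy_prodMk_of_indepFun _ hX hZ (IndepFun.cond_of_prodMk μ hM hIndep hm h0),
      hZlaw, mul_add]
  unfold condEntropy
  rw [Finset.sum_congr rfl fun m _ => key m, Finset.sum_add_distrib, ← Finset.sum_mul,
    sum_toReal_measure_preimage_singleton μ hM, one_mul]
end

section
/- (Mathematical core of Theorem 1.) Let (G, A, D, M_0, z_0,…,z_{k−1}, f_0,…,f_{k−1}, M_1,…,M_k) and (G′, A′, D′, M′_0, z′_0,…,z′_{k−1}, f′_0,…,f′_{k−1}, M′_1,…,M′_k) be two admissible length-k trajectory models with k ≥ 1 (on possibly different probability spaces). If for every 0 ≤ j ≤ k−1 one has the strict inequality H( f_j(M_j, D) | M_j ) > H( f′_j(M′_j, D′) | M′_j ), then I(D; (M_0, M_1, …, M_k)) > I(D′; (M′_0, M′_1, …, M′_k)). -/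
open MeasureTheory ProbabilityTheory

/-- `X` is conditionally independent of `W` given `Y`: for every value `y` of `Y` with
positive probability, the conditional joint pmf of `(X, W)` given `{Y = y}` factorizes
into the product of the conditional marginals. -/
def CondIndepFun {Ω S U T : Type*} [MeasurableSpace Ω]
    (μ : Measure Ω) (X : Ω → S) (W : Ω → U) (Y : Ω → T) : Prop :=
  ∀ y : T, 0 < μ (Y ⁻¹' {y}) → ∀ (x : S) (w : U),
    (μ[|Y ⁻¹' {y}]) (X ⁻¹' {x} ∩ W ⁻¹' {w}) =
      (μ[|Y ⁻¹' {y}]) (X ⁻¹' {x}) * (μ[|Y ⁻¹' {y}]) (W ⁻¹' {w})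

/-- An admissible length-`k` trajectory model: data `D`, model states `M_0, …, M_k` in a
finite additive commutative group `G`, noises `Z_0, …, Z_{k−1}` and update functions
`f_0, …, f_{k−1}` such that
(0) `M_{j+1} = f_j (M_j, D) + Z_j` for `0 ≤ j ≤ k−1`;
(i) the family `{D, M_0, Z_0, …, Z_{k−1}}` is mutually independent (stated via the
    joint-pmf factorization, which characterizes mutual independence for finite-valued
    random variables);
(ii) for each `1 ≤ j ≤ k−1`, `M_{j+1}` is conditionally independent of `(M_0,…,M_{j−1})`
    given `M_j`, and also given `(D, M_j)`;
(iii) for each `0 ≤ j ≤ k−1` and each `m` with `P(M_j = m) > 0`, the addition map is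
    injective on the product of the support of `f_j(M_j, D)` jointly with `{M_j = m}`
    and the support of `Z_j`. -/
def Admissible {Ω G A : Type*} [MeasurableSpace Ω] [AddCommGroup G]
    (μ : MeasureTheory.Measure Ω) (k : ℕ) (D : Ω → A) (M : ℕ → Ω → G) (Z : ℕ → Ω → G)
    (f : ℕ → G × A → G) : Prop :=
  (∀ j < k, ∀ ω, M (j + 1) ω = f j (M j ω, D ω) + Z j ω) ∧
  (∀ (a : A) (m0 : G) (zs : Fin k → G),
      μ (D ⁻¹' {a} ∩ M 0 ⁻¹' {m0} ∩ ⋂ j : Fin k, Z j.val ⁻¹' {zs j}) =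
        μ (D ⁻¹' {a}) * μ (M 0 ⁻¹' {m0}) * ∏ j : Fin k, μ (Z j.val ⁻¹' {zs j})) ∧
  (∀ j, 1 ≤ j → j < k →
      CondIndepFun μ (M (j + 1)) (fun ω (i : Fin j) => M i.val ω) (M j) ∧
      CondIndepFun μ (M (j + 1)) (fun ω (i : Fin j) => M i.val ω)
        (fun ω => (D ω, M j ω))) ∧
  (∀ j < k, ∀ m : G, 0 < μ (M j ⁻¹' {m}) →
      Set.InjOn (fun p : G × G => p.1 + p.2)
        ({x : G | 0 < μ ((fun ω => f j (M j ω, D ω)) ⁻¹' {x} ∩ M j ⁻¹' {m})} ×ˢ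
          {zv : G | 0 < μ (Z j ⁻¹' {zv})}))

section FiniteEntropy

variable {Ω S T U : Type*} [MeasurableSpace Ω] {μ : Measure Ω} [IsProbabilityMeasure μ]
  [Fintype S] [MeasurableSpace S] [DiscreteMeasurableSpace S]
  [Fintype T] [MeasurableSpace T] [DiscreteMeasurableSpace T]
  [Fintype U] [MeasurableSpace U] [DiscreteMeasurableSpace U]

lemma sum_measureReal_inter_preimage_singleton {X : Ω → S} (hX : Measurable X) (B : Set Ω) :
    ∑ x, μ.real (B ∩ X ⁻¹' {x}) = μ.real B := by
  have hm : ∀ x, MeasurableSet (X ⁻¹' {x}) := fun x => hX .of_discrete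
  have h := MeasureTheory.sum_measureReal_preimage_singleton (μ := μ.restrict B)
    (Finset.univ : Finset S) (f := X) (fun x _ => hm x)
  simpa [measureReal_restrict_apply, hm, Set.inter_comm] using h

omit [Fintype T] [MeasurableSpace T] [DiscreteMeasurableSpace T] in
lemma measureReal_preimage_singleton_eq_sum [DecidableEq T] {V : Ω → S} (hV : Measurable V)
    {W : Ω → T} (g : S → T) (hW : ∀ ω, W ω = g (V ω)) (t : T) :
    μ.real (W ⁻¹' {t}) = ∑ s, if g s = t then μ.real (V ⁻¹' {s}) else 0 := by
  rw [← sum_measureReal_inter_preimage_singleton hV]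
  refine Finset.sum_congr rfl fun s _ => ?_
  split_ifs with h
  · congr 1
    ext ω
    simp only [Set.mem_inter_iff, Set.mem_preimage, Set.mem_singleton_iff, hW, and_iff_right_iff_imp]
    rintro rfl
    exact h
  · have : W ⁻¹' {t} ∩ V ⁻¹' {s} = ∅ := by
      ext ω
      simp only [Set.mem_inter_iff, Set.mem_preimage, Set.mem_singleton_iff, hW,
        Set.mem_empty_iff_false, iff_false, not_and]
      rintro h1 rfl
      exact h h1
    simp [this]

omit [MeasurableSpace T] [DiscreteMeasurableSpace T] in
/-- The entropy of a function of `V`, computed as an expectation over the law of `V`. -/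
lemma entropy_eq_sum_of_comp {V : Ω → S} (hV : Measurable V)
    {W : Ω → T} (g : S → T) (hW : ∀ ω, W ω = g (V ω)) :
    entropy μ W = ∑ s, -(μ.real (V ⁻¹' {s}) * Real.log (μ.real (W ⁻¹' {g s}))) := by
  classical
  have h : ∀ t, Real.negMulLog (μ (W ⁻¹' {t})).toReal =
      ∑ s, if g s = t then -(μ.real (V ⁻¹' {s}) * Real.log (μ.real (W ⁻¹' {t}))) else 0 := by
    intro t
    change Real.negMulLog (μ.real (W ⁻¹' {t})) = _
    rw [Real.negMulLog, neg_mul]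
    generalize Real.log (μ.real (W ⁻¹' {t})) = c
    rw [measureReal_preimage_singleton_eq_sum hV g hW t, Finset.sum_mul, ← Finset.sum_neg_distrib]
    refine Finset.sum_congr rfl fun s _ => ?_
    split_ifs <;> simp
  simp only [entropy, h]
  rw [Finset.sum_comm]
  simp

omit [Fintype S] [MeasurableSpace S] [DiscreteMeasurableSpace S]
  [Fintype T] [MeasurableSpace T] [DiscreteMeasurableSpace T] in
lemma measureReal_preimage_le_of_comp {V : Ω → S} {W : Ω → T} (g : S → T)
    (hW : ∀ ω, W ω = g (V ω)) (s : S) :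
    μ.real (V ⁻¹' {s}) ≤ μ.real (W ⁻¹' {g s}) := by
  refine measureReal_mono ?_
  rintro ω rfl
  exact hW ω

omit [MeasurableSpace T] [DiscreteMeasurableSpace T] in
lemma entropy_eq_of_injOn {V : Ω → S} (hV : Measurable V)
    {W : Ω → T} (g : S → T) (hW : ∀ ω, W ω = g (V ω))
    (hg : Set.InjOn g {s | 0 < μ.real (V ⁻¹' {s})}) :
    entropy μ W = entropy μ V := by
  classical
  rw [entropy_eq_sum_of_comp hV g hW, entropy_eq_sum_of_comp (W := V) hV id (fun _ => rfl)]
  refine Finset.sum_congr rfl fun s _ => ?_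
  rcases (measureReal_nonneg (μ := μ) (s := V ⁻¹' {s})).eq_or_lt with h0 | h0
  · simp [← h0]
  · rw [measureReal_preimage_singleton_eq_sum hV g hW, Finset.sum_eq_single s]
    · simp
    · intro s' _ hne
      split_ifs with h
      · by_contra h1
        exact hne (hg (measureReal_nonneg.lt_of_ne' h1) h0 h)
      · rfl
    · simp

lemma condEntropy_eq_sub {X : Ω → S} {Y : Ω → T} (hX : Measurable X) (hY : Measurable Y) :
    condEntropy μ X Y = entropy μ (fun ω => (X ω, Y ω)) - entropy μ Y := by
  rw [entropy_eq_sum_of_comp (W := Y) (hX.prodMk hY) Prod.snd (fun _ => rfl),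
    entropy_eq_sum_of_comp (W := fun ω => (X ω, Y ω)) (hX.prodMk hY) id (fun _ => rfl),
    ← Finset.sum_sub_distrib,
    Fintype.sum_prod_type_right]
  simp only [condEntropy, entropy, Finset.mul_sum]
  refine Finset.sum_congr rfl fun y _ => Finset.sum_congr rfl fun x _ => ?_
  have hle := measureReal_preimage_le_of_comp (μ := μ) (V := fun ω => (X ω, Y ω)) (W := Y)
    Prod.snd (fun _ => rfl) (x, y)
  have hset : Y ⁻¹' {y} ∩ X ⁻¹' {x} = (fun ω => (X ω, Y ω)) ⁻¹' {(x, y)} := by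
    ext ω
    simp [and_comm]
  rw [ProbabilityTheory.cond_apply (hY .of_discrete), hset, ENNReal.toReal_mul,
    ENNReal.toReal_inv]
  change μ.real _ * Real.negMulLog ((μ.real _)⁻¹ * μ.real _) = _
  rcases (measureReal_nonneg (μ := μ) (s := (fun ω => (X ω, Y ω)) ⁻¹' {(x, y)})).eq_or_lt
    with h0 | h0
  · simp [← h0]
  · have h1 : 0 < μ.real (Y ⁻¹' {y}) := h0.trans_le hle
    rw [Real.negMulLog, Real.log_mul (by positivity) h0.ne', Real.log_inv]
    simp only [id]
    field_simp
    ring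

lemma entropy_prod_of_indep {X : Ω → S} {Y : Ω → T} (hX : Measurable X) (hY : Measurable Y)
    (h : ∀ x y, μ.real ((fun ω => (X ω, Y ω)) ⁻¹' {(x, y)}) =
      μ.real (X ⁻¹' {x}) * μ.real (Y ⁻¹' {y})) :
    entropy μ (fun ω => (X ω, Y ω)) = entropy μ X + entropy μ Y := by
  have hV := hX.prodMk hY
  rw [entropy_eq_sum_of_comp (W := X) hV Prod.fst (fun _ => rfl),
    entropy_eq_sum_of_comp (W := Y) hV Prod.snd (fun _ => rfl),
    entropy_eq_sum_of_comp (W := fun ω => (X ω, Y ω)) hV id (fun _ => rfl),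
    ← Finset.sum_add_distrib]
  refine Finset.sum_congr rfl fun ⟨x, y⟩ _ => ?_
  simp only [id, h]
  by_cases hx : μ.real (X ⁻¹' {x}) = 0
  · simp [hx]
  by_cases hy : μ.real (Y ⁻¹' {y}) = 0
  · simp [hy]
  rw [Real.log_mul hx hy]
  ring

omit [Fintype S] [MeasurableSpace S] [DiscreteMeasurableSpace S]
  [Fintype T] [Fintype U] [MeasurableSpace U] [DiscreteMeasurableSpace U] in
lemma CondIndepFun.measureReal_mul {X : Ω → S} {W : Ω → U} {Y : Ω → T} (hY : Measurable Y)
    (h : CondIndepFun μ X W Y) (x : S) (w : U) (y : T) :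
    μ.real ((fun ω => (X ω, W ω, Y ω)) ⁻¹' {(x, w, y)}) * μ.real (Y ⁻¹' {y}) =
      μ.real ((fun ω => (X ω, Y ω)) ⁻¹' {(x, y)}) *
        μ.real ((fun ω => (W ω, Y ω)) ⁻¹' {(w, y)}) := by
  rcases eq_or_ne (μ (Y ⁻¹' {y})) 0 with h0 | h0
  · have h1 := measureReal_preimage_le_of_comp (μ := μ) (V := fun ω => (X ω, Y ω)) (W := Y)
      Prod.snd (fun _ => rfl) (x, y)
    simp only [Measure.real, h0, ENNReal.toReal_zero] at h1 ⊢
    rw [le_antisymm h1 ENNReal.toReal_nonneg]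
    simp
  · have h1 := congrArg ENNReal.toReal (h y h0.bot_lt x w)
    have e1 : Y ⁻¹' {y} ∩ (X ⁻¹' {x} ∩ W ⁻¹' {w}) =
        (fun ω => (X ω, W ω, Y ω)) ⁻¹' {(x, w, y)} := by
      ext ω; simp; tauto
    have e2 : Y ⁻¹' {y} ∩ X ⁻¹' {x} = (fun ω => (X ω, Y ω)) ⁻¹' {(x, y)} := by
      ext ω; simp [and_comm]
    have e3 : Y ⁻¹' {y} ∩ W ⁻¹' {w} = (fun ω => (W ω, Y ω)) ⁻¹' {(w, y)} := by
      ext ω; simp [and_comm]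
    simp only [ProbabilityTheory.cond_apply (hY .of_discrete), e1, e2, e3,
      ENNReal.toReal_mul, ENNReal.toReal_inv] at h1
    have h2 : (μ (Y ⁻¹' {y})).toReal ≠ 0 := ENNReal.toReal_ne_zero.2 ⟨h0, measure_ne_top _ _⟩
    simp only [Measure.real]
    field_simp at h1
    linarith

lemma CondIndepFun.entropy_add {X : Ω → S} {W : Ω → U} {Y : Ω → T} (hX : Measurable X)
    (hW : Measurable W) (hY : Measurable Y) (h : CondIndepFun μ X W Y) :
    entropy μ (fun ω => (X ω, W ω, Y ω)) + entropy μ Y =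
      entropy μ (fun ω => (X ω, Y ω)) + entropy μ (fun ω => (W ω, Y ω)) := by
  have hV := hX.prodMk (hW.prodMk hY)
  rw [entropy_eq_sum_of_comp (W := Y) hV (fun p => p.2.2) (fun _ => rfl),
    entropy_eq_sum_of_comp (W := fun ω => (X ω, Y ω)) hV (fun p => (p.1, p.2.2)) (fun _ => rfl),
    entropy_eq_sum_of_comp (W := fun ω => (W ω, Y ω)) hV (fun p => p.2) (fun _ => rfl),
    entropy_eq_sum_of_comp (W := fun ω => (X ω, W ω, Y ω)) hV id (fun _ => rfl),
    ← Finset.sum_add_distrib, ← Finset.sum_add_distrib]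
  refine Finset.sum_congr rfl fun ⟨x, w, y⟩ _ => ?_
  simp only [id]
  have hm := h.measureReal_mul hY x w y
  have hle := measureReal_preimage_le_of_comp (μ := μ) (V := fun ω => (X ω, W ω, Y ω)) (W := Y)
    (fun p => p.2.2) (fun _ => rfl) (x, w, y)
  rcases (measureReal_nonneg (μ := μ)
    (s := (fun ω => (X ω, W ω, Y ω)) ⁻¹' {(x, w, y)})).eq_or_lt with h0 | h0
  · simp [← h0]
  · have h1 : μ.real (Y ⁻¹' {y}) ≠ 0 := (h0.trans_le hle).ne'
    have h2 := mul_ne_zero h0.ne' h1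
    have h3 := congrArg Real.log hm
    rw [hm] at h2
    rw [Real.log_mul h0.ne' h1, Real.log_mul (left_ne_zero_of_mul h2) (right_ne_zero_of_mul h2)]
      at h3
    linear_combination (-μ.real ((fun ω => (X ω, W ω, Y ω)) ⁻¹' {(x, w, y)})) * h3

omit [Fintype T] [MeasurableSpace T] [DiscreteMeasurableSpace T]
  [Fintype U] [MeasurableSpace U] [DiscreteMeasurableSpace U] in
lemma measureReal_prod_of_comp_indep {V : Ω → S} {W : Ω → T} {Z : Ω → U}
    (hV : Measurable V) (g : S → T) (hW : ∀ ω, W ω = g (V ω))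
    (h : ∀ s z, μ.real ((fun ω => (V ω, Z ω)) ⁻¹' {(s, z)}) =
      μ.real (V ⁻¹' {s}) * μ.real (Z ⁻¹' {z})) (t : T) (z : U) :
    μ.real ((fun ω => (W ω, Z ω)) ⁻¹' {(t, z)}) = μ.real (W ⁻¹' {t}) * μ.real (Z ⁻¹' {z}) := by
  classical
  rw [measureReal_preimage_singleton_eq_sum hV g hW, Finset.sum_mul,
    ← sum_measureReal_inter_preimage_singleton hV]
  refine Finset.sum_congr rfl fun s _ => ?_
  split_ifs with hs
  · rw [← h]
    congr 1
    ext ω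
    simp [hW]
    grind
  · rw [zero_mul]
    convert measureReal_empty
    ext ω
    simp [hW]
    grind

end FiniteEntropy

section Trajectory

variable {Ω G A : Type*} [MeasurableSpace Ω] {μ : Measure Ω} [IsProbabilityMeasure μ]
  [Fintype G] [AddCommGroup G] [MeasurableSpace G] [DiscreteMeasurableSpace G]
  [Fintype A] [MeasurableSpace A] [DiscreteMeasurableSpace A]
  {k : ℕ} {D : Ω → A} {M Z : ℕ → Ω → G} {f : ℕ → G × A → G}

omit [Fintype A] [MeasurableSpace A] [DiscreteMeasurableSpace A] in
lemma Admissible.measureReal_prefix (hZ : ∀ j, Measurable (Z j)) (h : Admissible μ k D M Z f)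
    (a : A) (m : G) (y : ℕ → G) {n : ℕ} (hn : n ≤ k) :
    μ.real {ω | D ω = a ∧ M 0 ω = m ∧ ∀ i < n, Z i ω = y i} =
      μ.real (D ⁻¹' {a}) * μ.real (M 0 ⁻¹' {m}) *
        ∏ i ∈ Finset.range n, μ.real (Z i ⁻¹' {y i}) := by
  induction hn using Nat.decreasingInduction generalizing y with
  | self =>
    have h1 := congrArg ENNReal.toReal (h.2.1 a m (fun i => y i))
    rw [ENNReal.toReal_mul, ENNReal.toReal_mul, ENNReal.toReal_prod] at h1
    rw [Finset.prod_range]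
    simp only [Measure.real]
    rw [← h1]
    congr 2
    ext ω
    simp [Fin.forall_iff, and_assoc]
  | of_succ n hn ih =>
    rw [← sum_measureReal_inter_preimage_singleton (hZ n)]
    have hsum : ∑ z, μ.real (Z n ⁻¹' {z}) = 1 := by
      simpa using sum_measureReal_inter_preimage_singleton (μ := μ) (hZ n) Set.univ
    rw [← mul_one (_ * ∏ i ∈ _, _), ← hsum, Finset.mul_sum]
    refine Finset.sum_congr rfl fun z _ => ?_
    have h2 := ih (Function.update y n z)
    rw [Finset.prod_range_succ, ← mul_assoc] at h2
    have h3 : ∀ i ∈ Finset.range n, μ.real (Z i ⁻¹' {Function.update y n z i}) =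
        μ.real (Z i ⁻¹' {y i}) := by
      intro i hi
      rw [Function.update_of_ne (Finset.mem_range.1 hi).ne]
    rw [Finset.prod_congr rfl h3, Function.update_self] at h2
    rw [← h2]
    congr 1
    ext ω
    simp only [Set.mem_inter_iff, Set.mem_ofPred_eq, Set.mem_preimage, Set.mem_singleton_iff,
      Nat.forall_lt_succ_right, Function.update_self, and_assoc]
    have h4 : (∀ i < n, Z i ω = Function.update y n z i) ↔ ∀ i < n, Z i ω = y i :=
      forall₂_congr fun i hi => by rw [Function.update_of_ne hi.ne]
    rw [h4]

omit [IsProbabilityMeasure μ] [Fintype G] [MeasurableSpace G] [DiscreteMeasurableSpace G]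
  [Fintype A] [MeasurableSpace A] [DiscreteMeasurableSpace A] in
lemma Admissible.trajectory_eq_iff (h : Admissible μ k D M Z f) (a : A) (m : ℕ → G) {n : ℕ}
    (hn : n ≤ k) (ω : Ω) :
    (D ω = a ∧ ∀ i ≤ n, M i ω = m i) ↔
      (D ω = a ∧ M 0 ω = m 0 ∧ ∀ i < n, Z i ω = m (i + 1) - f i (m i, a)) := by
  refine and_congr_right fun hD => ⟨fun hm => ⟨hm 0 (Nat.zero_le _), fun i hi => ?_⟩,
    fun ⟨h0, hz⟩ i hi => ?_⟩
  · rw [← hm (i + 1) hi, ← hm i hi.le, h.1 i (hi.trans_le hn) ω, hD]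
    abel
  · induction i with
    | zero => exact h0
    | succ i ih =>
      rw [h.1 i (hi.trans hn) ω, hz i hi, ih (by omega), hD]
      abel

omit [Fintype A] [MeasurableSpace A] [DiscreteMeasurableSpace A] in
lemma Admissible.indep_noise (hZ : ∀ j, Measurable (Z j)) (h : Admissible μ k D M Z f)
    {j : ℕ} (hj : j < k) (p : A × (Fin (j + 1) → G)) (z : G) :
    μ.real ((fun ω => ((D ω, fun i : Fin (j + 1) => M i ω), Z j ω)) ⁻¹' {(p, z)}) =
      μ.real ((fun ω => (D ω, fun i : Fin (j + 1) => M i ω)) ⁻¹' {p}) *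
        μ.real (Z j ⁻¹' {z}) := by
  obtain ⟨a, t⟩ := p
  let m : ℕ → G := fun i => if hi : i < j + 1 then t ⟨i, hi⟩ else z + f j (t (Fin.last j), a)
  have hm : ∀ i : Fin (j + 1), m i = t i := fun i => dif_pos i.isLt
  have ht : ∀ ω, ((fun i : Fin (j + 1) => M i ω) = t ↔ ∀ i ≤ j, M i ω = m i) := by
    intro ω
    simp only [funext_iff, Fin.forall_iff, ← hm, Nat.lt_succ_iff]
  have hz : m (j + 1) - f j (m j, a) = z := by
    have : m j = t (Fin.last j) := hm (Fin.last j)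
    rw [this]
    simp [m]
  have e1 : (fun ω => (D ω, fun i : Fin (j + 1) => M i ω)) ⁻¹' {(a, t)} =
      {ω | D ω = a ∧ M 0 ω = m 0 ∧ ∀ i < j, Z i ω = m (i + 1) - f i (m i, a)} := by
    ext ω
    rw [Set.mem_ofPred_eq, ← h.trajectory_eq_iff a m hj.le]
    simp [ht]
  have e2 : (fun ω => ((D ω, fun i : Fin (j + 1) => M i ω), Z j ω)) ⁻¹' {((a, t), z)} =
      {ω | D ω = a ∧ M 0 ω = m 0 ∧ ∀ i < j + 1, Z i ω = m (i + 1) - f i (m i, a)} := by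
    ext ω
    have := Set.ext_iff.1 e1 ω
    simp only [Set.mem_preimage, Set.mem_singleton_iff, Set.mem_ofPred_eq, Prod.mk.injEq] at this
    simp only [Set.mem_preimage, Set.mem_singleton_iff, Set.mem_ofPred_eq, Prod.mk.injEq, this,
      Nat.forall_lt_succ_right, hz]
    tauto
  rw [e1, e2, h.measureReal_prefix hZ a (m 0) (fun i => m (i + 1) - f i (m i, a)) hj,
    h.measureReal_prefix hZ a (m 0) (fun i => m (i + 1) - f i (m i, a)) hj.le,
    Finset.prod_range_succ, hz]
  ring

omit [Fintype G] [MeasurableSpace G] [DiscreteMeasurableSpace G]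
  [Fintype A] [MeasurableSpace A] [DiscreteMeasurableSpace A] in
lemma Admissible.condIndepFun_next (h : Admissible μ k D M Z f)
    {j : ℕ} (hj : j < k) :
    CondIndepFun μ (M (j + 1)) (fun ω (i : Fin j) => M i.val ω) (M j) := by
  rcases Nat.eq_zero_or_pos j with rfl | h0
  · intro y hy x w
    have := ProbabilityTheory.cond_isProbabilityMeasure hy.ne'
    have e : (fun ω (i : Fin 0) => M i.val ω) ⁻¹' {w} = Set.univ := by
      ext ω
      simp [eq_iff_true_of_subsingleton]
    simp [e]
  · exact (h.2.2.1 j h0 hj).1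

lemma Admissible.entropy_next (hD : Measurable D) (hM : ∀ j, Measurable (M j))
    (hZ : ∀ j, Measurable (Z j)) (h : Admissible μ k D M Z f) {j : ℕ} (hj : j < k) :
    entropy μ (fun ω => (M (j + 1) ω, M j ω)) =
      entropy μ (fun ω => (f j (M j ω, D ω), M j ω)) + entropy μ (Z j) := by
  have hT : Measurable fun ω => (D ω, fun i : Fin (j + 1) => M i ω) :=
    hD.prodMk (measurable_pi_lambda _ fun i => hM i)
  have hF : Measurable fun ω => (f j (M j ω, D ω), M j ω) :=
    ((measurable_of_finite (f j)).comp ((hM j).prodMk hD)).prodMk (hM j)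
  rw [← entropy_prod_of_indep hF (hZ j) (measureReal_prod_of_comp_indep hT
    (fun p => (f j (p.2 (Fin.last j), p.1), p.2 (Fin.last j))) (fun ω => rfl)
    (h.indep_noise hZ hj))]
  refine entropy_eq_of_injOn (hF.prodMk (hZ j)) (fun p => (p.1.1 + p.2, p.1.2))
    (fun ω => by rw [h.1 j hj ω]) ?_
  have key : ∀ (x m z : G),
      0 < μ.real ((fun ω => ((f j (M j ω, D ω), M j ω), Z j ω)) ⁻¹' {((x, m), z)}) →
      0 < μ (M j ⁻¹' {m}) ∧ (x, z) ∈
        ({x : G | 0 < μ ((fun ω => f j (M j ω, D ω)) ⁻¹' {x} ∩ M j ⁻¹' {m})} ×ˢ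
          {zv : G | 0 < μ (Z j ⁻¹' {zv})}) := by
    intro x m z hpos
    have hpos' := (ENNReal.toReal_pos_iff.1 hpos).1
    refine ⟨hpos'.trans_le (measure_mono ?_), hpos'.trans_le (measure_mono ?_),
      hpos'.trans_le (measure_mono ?_)⟩ <;> intro ω hω <;>
      simp only [Set.mem_preimage, Set.mem_singleton_iff, Prod.mk.injEq, Set.mem_inter_iff] at hω ⊢ <;>
      tauto
  rintro ⟨⟨x, m⟩, z⟩ hp ⟨⟨x', m'⟩, z'⟩ hp' heq
  obtain ⟨hadd, rfl⟩ := Prod.mk.inj heq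
  have h1 := h.2.2.2 j hj m (key _ _ _ hp).1 (key _ _ _ hp).2 (key _ _ _ hp').2 hadd
  grind

/-- One step of the trajectory adds the conditional update entropy to the information about the
data. -/
lemma Admissible.mutualInfo_succ (hD : Measurable D) (hM : ∀ j, Measurable (M j))
    (hZ : ∀ j, Measurable (Z j)) (h : Admissible μ k D M Z f) {j : ℕ} (hj : j < k) :
    mutualInfo μ D (fun ω (i : Fin (j + 2)) => M i.val ω) =
      mutualInfo μ D (fun ω (i : Fin (j + 1)) => M i.val ω) +
        condEntropy μ (fun ω => f j (M j ω, D ω)) (M j) := by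
  have hT : ∀ n, Measurable fun ω (i : Fin n) => M i.val ω :=
    fun n => measurable_pi_lambda _ fun i => hM i
  have hF : Measurable fun ω => f j (M j ω, D ω) :=
    (measurable_of_finite (f j)).comp ((hM j).prodMk hD)
  have e1 : entropy μ (fun ω => ((D ω, fun i : Fin (j + 1) => M i.val ω), Z j ω)) =
      entropy μ (fun ω => (D ω, fun i : Fin (j + 2) => M i.val ω)) := by
    refine entropy_eq_of_injOn (hD.prodMk (hT _)) (fun p => ((p.1, fun i => p.2 i.castSucc),
      p.2 (Fin.last _) - f j (p.2 (Fin.last j).castSucc, p.1))) (fun ω => ?_)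
      (Function.Injective.injOn ?_)
    · simp [h.1 j hj ω]
    · rintro ⟨a, t⟩ ⟨a', t'⟩ heq
      simp only [Prod.mk.injEq, funext_iff] at heq
      obtain ⟨⟨rfl, h1⟩, h2⟩ := heq
      rw [h1, sub_left_inj] at h2
      simp only [Prod.mk.injEq, true_and]
      exact funext (Fin.lastCases h2 h1)
  have e2 : entropy μ (fun ω => (M (j + 1) ω, (fun i : Fin j => M i.val ω), M j ω)) =
      entropy μ (fun ω (i : Fin (j + 2)) => M i.val ω) := by
    refine entropy_eq_of_injOn (hT _) (fun t => (t (Fin.last _),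
      (fun i => t i.castSucc.castSucc), t (Fin.last _).castSucc)) (fun ω => rfl)
      (Function.Injective.injOn ?_)
    intro t t' heq
    simp only [Prod.mk.injEq, funext_iff] at heq
    exact funext (Fin.lastCases heq.1 (Fin.lastCases heq.2.2 heq.2.1))
  have e3 : entropy μ (fun ω => ((fun i : Fin j => M i.val ω), M j ω)) =
      entropy μ (fun ω (i : Fin (j + 1)) => M i.val ω) := by
    refine entropy_eq_of_injOn (hT _) (fun t => ((fun i => t i.castSucc), t (Fin.last _)))
      (fun ω => rfl) (Function.Injective.injOn ?_)
    intro t t' heq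
    simp only [Prod.mk.injEq, funext_iff] at heq
    exact funext (Fin.lastCases heq.2 heq.1)
  have h1 := entropy_prod_of_indep (hD.prodMk (hT (j + 1))) (hZ j) (h.indep_noise hZ hj)
  have h2 := (h.condIndepFun_next hj).entropy_add (hM _) (hT j) (hM j)
  have h3 := h.entropy_next hD hM hZ hj
  rw [mutualInfo, mutualInfo, condEntropy_eq_sub hD (hT _), condEntropy_eq_sub hD (hT _),
    condEntropy_eq_sub hF (hM j)]
  linarith

lemma Admissible.mutualInfo_initial (hD : Measurable D) (hM : ∀ j, Measurable (M j))
    (hZ : ∀ j, Measurable (Z j)) (h : Admissible μ k D M Z f) :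
    mutualInfo μ D (fun ω (i : Fin 1) => M i.val ω) = 0 := by
  have hT : Measurable fun ω (i : Fin 1) => M i.val ω :=
    measurable_pi_lambda _ fun i => hM i
  rw [mutualInfo, condEntropy_eq_sub hD hT, entropy_prod_of_indep hD hT]
  · ring
  · intro a t
    have h1 := h.measureReal_prefix hZ a (t 0) 0 (Nat.zero_le k)
    simp only [Finset.range_zero, Finset.prod_empty, mul_one] at h1
    convert h1 using 2
    · ext ω
      simp [funext_iff]
    · congr 1
      ext ω
      simp [funext_iff]

/-- The information about the data carried by the trajectory is the sum of the conditional
update entropies. -/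
lemma Admissible.mutualInfo_eq_sum (hD : Measurable D) (hM : ∀ j, Measurable (M j))
    (hZ : ∀ j, Measurable (Z j)) (h : Admissible μ k D M Z f) {n : ℕ} (hn : n ≤ k) :
    mutualInfo μ D (fun ω (i : Fin (n + 1)) => M i.val ω) =
      ∑ j ∈ Finset.range n, condEntropy μ (fun ω => f j (M j ω, D ω)) (M j) := by
  induction n with
  | zero => simpa using h.mutualInfo_initial hD hM hZ
  | succ n ih => rw [Finset.sum_range_succ, ← ih (by omega), h.mutualInfo_succ hD hM hZ hn]

end Trajectory

/-- Mathematical core of Theorem 1: for two admissible length-`k` trajectory models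
(`k ≥ 1`, on possibly different probability spaces), if every per-step conditional
update entropy of the first model strictly exceeds that of the second, then the
data–trajectory mutual information of the first model strictly exceeds that of the
second. -/
theorem mutualInfo_data_trajectory_lt_of_condEntropy_updates_lt
    {Ω : Type*} [MeasurableSpace Ω] (μ : Measure Ω) [IsProbabilityMeasure μ]
    {Ω' : Type*} [MeasurableSpace Ω'] (μ' : Measure Ω') [IsProbabilityMeasure μ']
    {G : Type*} [Fintype G] [AddCommGroup G]
    [MeasurableSpace G] [DiscreteMeasurableSpace G]
    {A : Type*} [Fintype A] [MeasurableSpace A] [DiscreteMeasurableSpace A]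
    {G' : Type*} [Fintype G'] [AddCommGroup G']
    [MeasurableSpace G'] [DiscreteMeasurableSpace G']
    {A' : Type*} [Fintype A'] [MeasurableSpace A'] [DiscreteMeasurableSpace A']
    {k : ℕ} (hk : 1 ≤ k)
    (D : Ω → A) (M Z : ℕ → Ω → G) (f : ℕ → G × A → G)
    (hD : Measurable D) (hM : ∀ j, Measurable (M j)) (hZ : ∀ j, Measurable (Z j))
    (hAdm : Admissible μ k D M Z f)
    (D' : Ω' → A') (M' Z' : ℕ → Ω' → G') (f' : ℕ → G' × A' → G')
    (hD' : Measurable D') (hM' : ∀ j, Measurable (M' j)) (hZ' : ∀ j, Measurable (Z' j))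
    (hAdm' : Admissible μ' k D' M' Z' f')
    (hlt : ∀ j < k,
      condEntropy μ' (fun ω => f' j (M' j ω, D' ω)) (M' j) <
        condEntropy μ (fun ω => f j (M j ω, D ω)) (M j)) :
    mutualInfo μ' D' (fun ω (j : Fin (k + 1)) => M' j.val ω) <
      mutualInfo μ D (fun ω (j : Fin (k + 1)) => M j.val ω) := by
  rw [hAdm.mutualInfo_eq_sum hD hM hZ le_rfl, hAdm'.mutualInfo_eq_sum hD' hM' hZ' le_rfl]
  exact Finset.sum_lt_sum_of_nonempty (Finset.nonempty_range_iff.2 (by omega))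
    fun j hj => hlt j (Finset.mem_range.1 hj)
end

section
/- (Honest training beats reverse algorithm-manipulation attacks.) Let (G, A, D, M_0, z_0,…,z_{k−1}, f_0,…,f_{k−1}, M_1,…,M_k) be an admissible length-k trajectory model with k ≥ 1, and suppose there exists some 0 ≤ j* ≤ k−1 with H( f_{j*}(M_{j*}, D) | M_{j*} ) > 0. Let G′ be a finite additive commutative group, D′ a random variable with values in a finite type A′, M′_0 and z′_0,…,z′_{k−1} G′-valued random variables such that the family {D′, M′_0, z′_0,…,z′_{k−1}} is mutually independent, g_0,…,g_{k−1} : G′ → G′ functions, and M′_{j+1} = g_j(M′_j) + z′_j for 0 ≤ j ≤ k−1. Then I(D; (M_0, M_1, …, M_k)) > I(D′; (M′_0, M′_1, …, M′_k)) = 0. -/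
open MeasureTheory ProbabilityTheory

section

variable {Ω S T : Type*} [MeasurableSpace Ω]

section Information

variable [Fintype S] [Fintype T]

lemma sum_measureReal_preimage_inter [MeasurableSpace T] [MeasurableSingletonClass T]
    (μ : Measure Ω) [IsFiniteMeasure μ] {Y : Ω → T} (hY : Measurable Y) {E : Set Ω}
    (hE : MeasurableSet E) : ∑ y : T, μ.real (E ∩ Y ⁻¹' {y}) = μ.real E := by
  have h := sum_measureReal_preimage_singleton (μ := μ.restrict E) (Finset.univ : Finset T)
    (f := Y) (fun y _ => hY (measurableSet_singleton y))
  simpa [measureReal_restrict_apply', hE, Set.inter_comm] using h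

lemma measureReal_mul_cond (μ : Measure Ω) [IsFiniteMeasure μ] {F : Set Ω}
    (hF : MeasurableSet F) (E : Set Ω) :
    μ.real F * (μ[|F]).real E = μ.real (E ∩ F) := by
  rw [Measure.real, Measure.real, Measure.real, ← ENNReal.toReal_mul, mul_comm,
    cond_mul_eq_inter hF, Set.inter_comm]

/-- The mutual information as a sum of Jensen gaps of `Real.negMulLog`. -/
lemma mutualInfo_eq_sum_jensen_gap [MeasurableSpace S] [MeasurableSingletonClass S]
    [MeasurableSpace T] [MeasurableSingletonClass T]
    (μ : Measure Ω) [IsProbabilityMeasure μ] {X : Ω → S} {Y : Ω → T}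
    (hX : Measurable X) (hY : Measurable Y) :
    mutualInfo μ X Y = ∑ x : S,
      (Real.negMulLog (∑ y : T, μ.real (Y ⁻¹' {y}) • (μ[|Y ⁻¹' {y}]).real (X ⁻¹' {x})) -
        ∑ y : T, μ.real (Y ⁻¹' {y}) • Real.negMulLog ((μ[|Y ⁻¹' {y}]).real (X ⁻¹' {x}))) := by
  simp only [smul_eq_mul, measureReal_mul_cond μ (hY (measurableSet_singleton _)),
    sum_measureReal_preimage_inter μ hY (hX (measurableSet_singleton _))]
  rw [Finset.sum_sub_distrib, Finset.sum_comm]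
  simp only [← Finset.mul_sum]
  rfl

lemma negMulLog_jensen_gap_nonneg [MeasurableSpace T] [MeasurableSingletonClass T]
    (μ : Measure Ω) [IsProbabilityMeasure μ] {Y : Ω → T} (hY : Measurable Y) (E : Set Ω) :
    0 ≤ Real.negMulLog (∑ y : T, μ.real (Y ⁻¹' {y}) • (μ[|Y ⁻¹' {y}]).real E) -
      ∑ y : T, μ.real (Y ⁻¹' {y}) • Real.negMulLog ((μ[|Y ⁻¹' {y}]).real E) :=
  sub_nonneg.2 <| Real.concaveOn_negMulLog.le_map_sum (fun _ _ => measureReal_nonneg)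
    (by simpa using sum_measureReal_preimage_inter μ hY MeasurableSet.univ)
    (fun _ _ => measureReal_nonneg)

lemma mutualInfo_nonneg [MeasurableSpace S] [MeasurableSingletonClass S]
    [MeasurableSpace T] [MeasurableSingletonClass T]
    (μ : Measure Ω) [IsProbabilityMeasure μ] {X : Ω → S} {Y : Ω → T}
    (hX : Measurable X) (hY : Measurable Y) : 0 ≤ mutualInfo μ X Y := by
  rw [mutualInfo_eq_sum_jensen_gap μ hX hY]
  exact Finset.sum_nonneg fun _ _ => negMulLog_jensen_gap_nonneg μ hY _

/-- The mutual information vanishes exactly when the joint pmf factorizes. -/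
lemma mutualInfo_eq_zero_iff [MeasurableSpace S] [MeasurableSingletonClass S]
    [MeasurableSpace T] [MeasurableSingletonClass T]
    (μ : Measure Ω) [IsProbabilityMeasure μ] {X : Ω → S} {Y : Ω → T}
    (hX : Measurable X) (hY : Measurable Y) :
    mutualInfo μ X Y = 0 ↔
      ∀ x y, μ (X ⁻¹' {x} ∩ Y ⁻¹' {y}) = μ (X ⁻¹' {x}) * μ (Y ⁻¹' {y}) := by
  rw [mutualInfo_eq_sum_jensen_gap μ hX hY,
    Finset.sum_eq_zero_iff_of_nonneg fun _ _ => negMulLog_jensen_gap_nonneg μ hY _]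
  refine ⟨fun h x y => ?_, fun h x _ => ?_⟩
  all_goals
    have key := Real.strictConcaveOn_negMulLog.map_sum_eq_iff_of_nonneg
      (t := (Finset.univ : Finset T)) (w := fun y => μ.real (Y ⁻¹' {y}))
      (p := fun y => (μ[|Y ⁻¹' {y}]).real (X ⁻¹' {x})) (fun _ _ => measureReal_nonneg)
      (by simpa using sum_measureReal_preimage_inter μ hY MeasurableSet.univ)
      (fun _ _ => measureReal_nonneg)
    have hmul (y : T) := measureReal_mul_cond μ (hY (measurableSet_singleton y)) (X ⁻¹' {x})
    have hsum := sum_measureReal_preimage_inter μ hY (hX (measurableSet_singleton x))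
  · have hc := key.1 (sub_eq_zero.1 (h x (Finset.mem_univ _)))
    rw [← ENNReal.toReal_eq_toReal_iff' (by finiteness) (by finiteness), ENNReal.toReal_mul]
    change μ.real _ = μ.real _ * μ.real _
    by_cases hy : μ.real (Y ⁻¹' {y}) = 0
    · rw [hy, mul_zero, ← hmul, hy, zero_mul]
    · have hx : μ.real (X ⁻¹' {x}) = (μ[|Y ⁻¹' {y}]).real (X ⁻¹' {x}) := by
        rw [← hsum]
        have h1 : ∑ y' : T, μ.real (Y ⁻¹' {y'}) = 1 := by
          simpa using sum_measureReal_preimage_inter μ hY MeasurableSet.univ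
        rw [← one_mul ((μ[|Y ⁻¹' {y}]).real _), ← h1, Finset.sum_mul]
        refine Finset.sum_congr rfl fun y' _ => ?_
        rw [← hmul]
        by_cases hy' : μ.real (Y ⁻¹' {y'}) = 0
        · simp [hy']
        · rw [hc (Finset.mem_univ y') hy' (Finset.mem_univ y) hy]
      rw [hx, mul_comm, hmul]
  · have hval (y : T) (hy : μ.real (Y ⁻¹' {y}) ≠ 0) :
        (μ[|Y ⁻¹' {y}]).real (X ⁻¹' {x}) = μ.real (X ⁻¹' {x}) := by
      apply mul_left_cancel₀ hy
      rw [hmul, Measure.real, h, ENNReal.toReal_mul, mul_comm]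
      rfl
    exact sub_eq_zero.2 (key.2 fun y _ hy y' _ hy' => by rw [hval y hy, hval y' hy'])

lemma exists_measure_inter_preimage_pos (μ : Measure Ω) (Y : Ω → T) {E : Set Ω}
    (hE : 0 < μ E) : ∃ y, 0 < μ (E ∩ Y ⁻¹' {y}) := by
  by_contra! h
  refine hE.ne' (measure_mono_null (t := ⋃ y, E ∩ Y ⁻¹' {y}) (fun ω hω => ?_)
    (measure_iUnion_null fun y => le_antisymm (h y) zero_le))
  exact Set.mem_iUnion.2 ⟨Y ω, hω, rfl⟩

/-- A positive conditional entropy yields two distinct values of `X` which are both possible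
together with a common value of `Y`. -/
lemma exists_ne_of_condEntropy_pos [MeasurableSpace S] [MeasurableSingletonClass S]
    [MeasurableSpace T] [MeasurableSingletonClass T]
    (μ : Measure Ω) [IsFiniteMeasure μ] {X : Ω → S} {Y : Ω → T}
    (hX : Measurable X) (hY : Measurable Y) (h : 0 < condEntropy μ X Y) :
    ∃ y x x', x ≠ x' ∧ 0 < μ (X ⁻¹' {x} ∩ Y ⁻¹' {y}) ∧ 0 < μ (X ⁻¹' {x'} ∩ Y ⁻¹' {y}) := by
  obtain ⟨y, -, hy⟩ := Finset.exists_ne_zero_of_sum_ne_zero h.ne'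
  obtain ⟨hy0, hent⟩ := mul_ne_zero_iff.1 hy
  obtain ⟨x, -, hx⟩ := Finset.exists_ne_zero_of_sum_ne_zero hent
  have hYy : MeasurableSet (Y ⁻¹' {y}) := hY (measurableSet_singleton y)
  have hμy : μ (Y ⁻¹' {y}) ≠ 0 := fun h0 => hy0 (by simp [h0])
  have : IsProbabilityMeasure (μ[|Y ⁻¹' {y}]) := cond_isProbabilityMeasure hμy
  have hpos {E : Set Ω} (hE : 0 < (μ[|Y ⁻¹' {y}]) E) : 0 < μ (E ∩ Y ⁻¹' {y}) := by
    rw [Set.inter_comm, ← cond_mul_eq_inter hYy]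
    exact ENNReal.mul_pos hE.ne' hμy
  have hx0 : 0 < (μ[|Y ⁻¹' {y}]) (X ⁻¹' {x}) :=
    pos_iff_ne_zero.2 fun h0 => hx (by simp [h0])
  have hxc : 0 < (μ[|Y ⁻¹' {y}]) (X ⁻¹' {x})ᶜ := by
    refine pos_iff_ne_zero.2 fun h0 => hx ?_
    rw [prob_compl_eq_zero_iff (hX (measurableSet_singleton x))] at h0
    simp [h0]
  obtain ⟨x', hx'⟩ := exists_measure_inter_preimage_pos _ X hxc
  have hne : x ≠ x' := by
    rintro rfl
    simp at hx'
  exact ⟨y, x, x', hne, hpos hx0, hpos (hx'.trans_le (measure_mono Set.inter_subset_right))⟩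

end Information

lemma trajectory_preimage_eq {Ω A G : Type*} [AddCommGroup G] {k : ℕ} {D : Ω → A}
    {M Z : ℕ → Ω → G} {f : ℕ → G × A → G}
    (hrec : ∀ j < k, ∀ ω, M (j + 1) ω = f j (M j ω, D ω) + Z j ω) (a : A)
    (t : Fin (k + 1) → G) :
    D ⁻¹' {a} ∩ (fun ω (j : Fin (k + 1)) => M j.val ω) ⁻¹' {t} =
      D ⁻¹' {a} ∩ M 0 ⁻¹' {t 0} ∩
        ⋂ j : Fin k, Z j.val ⁻¹' {t j.succ - f j.val (t j.castSucc, a)} := by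
  ext ω
  simp only [Set.mem_inter_iff, Set.mem_preimage, Set.mem_singleton_iff, Set.mem_iInter, and_assoc]
  refine and_congr_right fun ha => ⟨?_, ?_⟩
  · rintro rfl
    refine ⟨rfl, fun j => ?_⟩
    simp [hrec j j.isLt ω, ha]
  · rintro ⟨h0, hZ⟩
    funext j
    induction j using Fin.induction with
    | zero => exact h0
    | succ j ih =>
      simp only [Fin.val_castSucc] at ih
      simp [hrec j j.isLt ω, ha, ih, hZ j]

lemma measure_data_inter_trajectory {A G : Type*} [AddCommGroup G] {k : ℕ} {μ : Measure Ω}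
    {D : Ω → A} {M Z : ℕ → Ω → G} {f : ℕ → G × A → G}
    (hrec : ∀ j < k, ∀ ω, M (j + 1) ω = f j (M j ω, D ω) + Z j ω)
    (hind : ∀ (a : A) (m0 : G) (zs : Fin k → G),
      μ (D ⁻¹' {a} ∩ M 0 ⁻¹' {m0} ∩ ⋂ j : Fin k, Z j.val ⁻¹' {zs j}) =
        μ (D ⁻¹' {a}) * μ (M 0 ⁻¹' {m0}) * ∏ j : Fin k, μ (Z j.val ⁻¹' {zs j}))
    (a : A) (t : Fin (k + 1) → G) :
    μ (D ⁻¹' {a} ∩ (fun ω (j : Fin (k + 1)) => M j.val ω) ⁻¹' {t}) =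
      μ (D ⁻¹' {a}) * (μ (M 0 ⁻¹' {t 0}) *
        ∏ j : Fin k, μ (Z j.val ⁻¹' {t j.succ - f j.val (t j.castSucc, a)})) := by
  rw [trajectory_preimage_eq hrec, hind a (t 0) fun j => t j.succ - f j.val (t j.castSucc, a),
    mul_assoc]

/-- If the updates do not depend on the data, the data carries no information about the
trajectory. -/
lemma mutualInfo_trajectory_eq_zero {A G : Type*} [Fintype A] [MeasurableSpace A]
    [MeasurableSingletonClass A] [Fintype G] [MeasurableSpace G] [MeasurableSingletonClass G]
    [AddCommGroup G] {k : ℕ} (μ : Measure Ω) [IsProbabilityMeasure μ]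
    {D : Ω → A} {M Z : ℕ → Ω → G} {g : ℕ → G → G}
    (hD : Measurable D) (hM : ∀ j, Measurable (M j))
    (hind : ∀ (a : A) (m0 : G) (zs : Fin k → G),
      μ (D ⁻¹' {a} ∩ M 0 ⁻¹' {m0} ∩ ⋂ j : Fin k, Z j.val ⁻¹' {zs j}) =
        μ (D ⁻¹' {a}) * μ (M 0 ⁻¹' {m0}) * ∏ j : Fin k, μ (Z j.val ⁻¹' {zs j}))
    (hrec : ∀ j < k, ∀ ω, M (j + 1) ω = g j (M j ω) + Z j ω) :
    mutualInfo μ D (fun ω (j : Fin (k + 1)) => M j.val ω) = 0 := by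
  have hT : Measurable (fun ω (j : Fin (k + 1)) => M j.val ω) :=
    measurable_pi_lambda _ fun j => hM j
  rw [mutualInfo_eq_zero_iff μ hD hT]
  have hfac := measure_data_inter_trajectory (f := fun j p => g j p.1) hrec hind
  intro a t
  have hmarg : μ ((fun ω (j : Fin (k + 1)) => M j.val ω) ⁻¹' {t}) =
      μ (M 0 ⁻¹' {t 0}) * ∏ j : Fin k, μ (Z j.val ⁻¹' {t j.succ - g j.val (t j.castSucc)}) := by
    have hone : ∑ a : A, μ (D ⁻¹' {a}) = 1 := by
      simpa using sum_measure_preimage_singleton (μ := μ) (Finset.univ : Finset A) (f := D)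
        fun a _ => hD (measurableSet_singleton a)
    have hsum := sum_measure_preimage_singleton
      (μ := μ.restrict ((fun ω (j : Fin (k + 1)) => M j.val ω) ⁻¹' {t}))
      (Finset.univ : Finset A) (f := D) fun a _ => hD (measurableSet_singleton a)
    simp only [Measure.restrict_apply (hD (measurableSet_singleton _)), hfac,
      ← Finset.sum_mul, hone] at hsum
    simpa using hsum.symm
  rw [hfac, hmarg]

/-- A step whose update is genuinely random given the current state reveals information about
the data. -/
lemma Admissible.mutualInfo_trajectory_pos {A G : Type*} [Fintype A] [MeasurableSpace A]
    [DiscreteMeasurableSpace A] [Fintype G] [MeasurableSpace G] [DiscreteMeasurableSpace G]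
    [AddCommGroup G] {k : ℕ} {μ : Measure Ω} [IsProbabilityMeasure μ]
    {D : Ω → A} {M Z : ℕ → Ω → G} {f : ℕ → G × A → G} (hAdm : Admissible μ k D M Z f)
    (hD : Measurable D) (hM : ∀ j, Measurable (M j))
    (hpos : ∃ j, j < k ∧ 0 < condEntropy μ (fun ω => f j (M j ω, D ω)) (M j)) :
    0 < mutualInfo μ D (fun ω (j : Fin (k + 1)) => M j.val ω) := by
  obtain ⟨hrec, hind, -, hinj⟩ := hAdm
  obtain ⟨j, hj, hent⟩ := hpos
  have hT : Measurable (fun ω (j : Fin (k + 1)) => M j.val ω) :=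
    measurable_pi_lambda _ fun j => hM j
  refine (mutualInfo_nonneg μ hD hT).lt_of_ne' fun h0 => ?_
  rw [mutualInfo_eq_zero_iff μ hD hT] at h0
  have hfac := measure_data_inter_trajectory hrec hind
  obtain ⟨m, x, x', hne, hx, hx'⟩ := exists_ne_of_condEntropy_pos μ
    ((measurable_of_finite (f j)).comp ((hM j).prodMk hD)) (hM j) hent
  obtain ⟨a, ha⟩ := exists_measure_inter_preimage_pos μ D hx
  obtain ⟨a', ha'⟩ := exists_measure_inter_preimage_pos μ D hx'
  have hval {x : G} {a : A} (h : 0 < μ ((fun ω => f j (M j ω, D ω)) ⁻¹' {x} ∩ M j ⁻¹' {m} ∩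
      D ⁻¹' {a})) : f j (m, a) = x := by
    obtain ⟨ω, ⟨hω, hm⟩, hωa⟩ := nonempty_of_measure_ne_zero h.ne'
    rw [← Set.mem_singleton_iff.1 hm, ← Set.mem_singleton_iff.1 hωa]
    exact hω
  obtain ⟨t, ht⟩ := exists_measure_inter_preimage_pos μ
    (fun ω (j : Fin (k + 1)) => M j.val ω) hx
  have htm : t (Fin.castSucc ⟨j, hj⟩) = m := by
    obtain ⟨ω, ⟨-, hm⟩, hωt⟩ := nonempty_of_measure_ne_zero ht.ne'
    rw [← Set.mem_singleton_iff.1 hωt]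
    exact hm
  have hnoise {a : A} (hD0 : 0 < μ (D ⁻¹' {a})) :
      0 < μ (Z j ⁻¹' {t (Fin.succ ⟨j, hj⟩) - f j (m, a)}) := by
    have hpos : 0 < μ (D ⁻¹' {a} ∩ (fun ω (j : Fin (k + 1)) => M j.val ω) ⁻¹' {t}) := by
      rw [h0]
      exact ENNReal.mul_pos hD0.ne' (ht.trans_le (measure_mono Set.inter_subset_right)).ne'
    rw [hfac] at hpos
    have hprod := right_ne_zero_of_mul (right_ne_zero_of_mul hpos.ne')
    have := Finset.prod_ne_zero_iff.1 hprod ⟨j, hj⟩ (Finset.mem_univ _)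
    rw [htm] at this
    exact pos_iff_ne_zero.2 this
  have hz := hnoise (ha.trans_le (measure_mono Set.inter_subset_right))
  have hz' := hnoise (ha'.trans_le (measure_mono Set.inter_subset_right))
  rw [hval ha] at hz
  rw [hval ha'] at hz'
  have heq := hinj j hj m (hx.trans_le (measure_mono Set.inter_subset_right))
    (Set.mk_mem_prod hx hz) (Set.mk_mem_prod hx' hz') (by simp)
  exact hne (congrArg Prod.fst heq)

end

/-- Honest training beats reverse algorithm-manipulation attacks: for an admissible
length-`k` trajectory model with some step of strictly positive conditional update
entropy, and any forged trajectory whose updates do not use the data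
(`M′_{j+1} = g_j(M′_j) + Z′_j` with `{D′, M′_0, Z′_0, …, Z′_{k−1}}` mutually
independent), one has `I(D; (M_0,…,M_k)) > I(D′; (M′_0,…,M′_k)) = 0`. -/
theorem honest_mutualInfo_gt_reverse_attack
    {Ω : Type*} [MeasurableSpace Ω] (μ : Measure Ω) [IsProbabilityMeasure μ]
    {Ω' : Type*} [MeasurableSpace Ω'] (μ' : Measure Ω') [IsProbabilityMeasure μ']
    {G : Type*} [Fintype G] [AddCommGroup G]
    [MeasurableSpace G] [DiscreteMeasurableSpace G]
    {A : Type*} [Fintype A] [MeasurableSpace A] [DiscreteMeasurableSpace A]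
    {G' : Type*} [Fintype G'] [AddCommGroup G']
    [MeasurableSpace G'] [DiscreteMeasurableSpace G']
    {A' : Type*} [Fintype A'] [MeasurableSpace A'] [DiscreteMeasurableSpace A']
    {k : ℕ} (hk : 1 ≤ k)
    (D : Ω → A) (M Z : ℕ → Ω → G) (f : ℕ → G × A → G)
    (hD : Measurable D) (hM : ∀ j, Measurable (M j)) (hZ : ∀ j, Measurable (Z j))
    (hAdm : Admissible μ k D M Z f)
    (hpos : ∃ j, j < k ∧ 0 < condEntropy μ (fun ω => f j (M j ω, D ω)) (M j))
    (D' : Ω' → A') (M' Z' : ℕ → Ω' → G') (g : ℕ → G' → G')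
    (hD' : Measurable D') (hM' : ∀ j, Measurable (M' j)) (hZ' : ∀ j, Measurable (Z' j))
    (hiIndep' : ∀ (a : A') (m0 : G') (zs : Fin k → G'),
      μ' (D' ⁻¹' {a} ∩ M' 0 ⁻¹' {m0} ∩ ⋂ j : Fin k, Z' j.val ⁻¹' {zs j}) =
        μ' (D' ⁻¹' {a}) * μ' (M' 0 ⁻¹' {m0}) * ∏ j : Fin k, μ' (Z' j.val ⁻¹' {zs j}))
    (hrec' : ∀ j < k, ∀ ω, M' (j + 1) ω = g j (M' j ω) + Z' j ω) :
    mutualInfo μ' D' (fun ω (j : Fin (k + 1)) => M' j.val ω) <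
        mutualInfo μ D (fun ω (j : Fin (k + 1)) => M j.val ω) ∧
      mutualInfo μ' D' (fun ω (j : Fin (k + 1)) => M' j.val ω) = 0 := by
  have hzero := mutualInfo_trajectory_eq_zero μ' hD' hM' hiIndep' hrec'
  exact ⟨hzero ▸ hAdm.mutualInfo_trajectory_pos hD hM hpos, hzero⟩
end
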